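/- arXiv:1609.07412 — 6 statements merged into one kernel-verified Lean document; each statement's English description precedes it below -/
import Mathlib

section
/- For every Schwartz function χ on ℝ³ and every x ∈ ℝ³, the principal value integral ψ(x) = lim_{ε→0⁺} ∫_{{x' : |x−x'| > ε}} d(x − x') χ(x') dx' exists (the limit is finite). -/
open MeasureTheory Filter

/-- Points of `ℝ³`. -/
abbrev E3 : Type := EuclideanSpace ℝ (Fin 3)

/-- The dipole kernel `d(x) = (2x₃² − x₁² − x₂²)/(4π|x|⁵)`. -/
noncomputable def dipole (x : E3) : ℝ :=
  (2 * (x 2) ^ 2 - (x 0) ^ 2 - (x 1) ^ 2) / (4 * Real.pi * ‖x‖ ^ 5)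

lemma dipole_zero : dipole 0 = 0 := by simp [dipole]

lemma norm_sq_eq_sum_three (x : E3) : ‖x‖ ^ 2 = x 0 ^ 2 + x 1 ^ 2 + x 2 ^ 2 := by
  rw [EuclideanSpace.norm_sq_eq, Fin.sum_univ_three]
  simp

lemma abs_dipole_mul_norm_pow_three_le (x : E3) : |dipole x| * ‖x‖ ^ 3 ≤ 1 := by
  rcases eq_or_ne x 0 with rfl | hx
  · simp
  have hn : 0 < ‖x‖ := norm_pos_iff.mpr hx
  have hnum : |2 * x 2 ^ 2 - x 0 ^ 2 - x 1 ^ 2| ≤ 2 * ‖x‖ ^ 2 := by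
    rw [norm_sq_eq_sum_three, abs_le]
    constructor <;> nlinarith [sq_nonneg (x 0), sq_nonneg (x 1), sq_nonneg (x 2)]
  have hden : 0 < 4 * Real.pi * ‖x‖ ^ 5 := by positivity
  rw [dipole, abs_div, abs_of_pos hden, div_mul_eq_mul_div, div_le_one hden]
  calc |2 * x 2 ^ 2 - x 0 ^ 2 - x 1 ^ 2| * ‖x‖ ^ 3 ≤ 2 * ‖x‖ ^ 2 * ‖x‖ ^ 3 := by gcongr
    _ = 2 * ‖x‖ ^ 5 := by ring
    _ ≤ 4 * Real.pi * ‖x‖ ^ 5 := by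
      gcongr
      linarith [Real.pi_gt_three]

lemma measurable_dipole : Measurable dipole := by
  unfold dipole
  fun_prop

/-- The spherical shell `ε < ‖y‖ ≤ 1`. -/
def annulus (ε : ℝ) : Set E3 := {y | ε < ‖y‖ ∧ ‖y‖ ≤ 1}

lemma measurableSet_annulus (ε : ℝ) : MeasurableSet (annulus ε) :=
  (measurableSet_lt measurable_const measurable_norm).inter
    (measurableSet_le measurable_norm measurable_const)

lemma integrable_indicator_annulus_dipole {ε : ℝ} (hε : 0 < ε) :
    Integrable ((annulus ε).indicator dipole) := by
  rw [integrable_indicator_iff (measurableSet_annulus ε)]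
  refine Measure.integrableOn_of_bounded (M := (ε ^ 3)⁻¹) ?_
    measurable_dipole.aestronglyMeasurable ?_
  · refine ((measure_mono ?_).trans_lt
      (measure_closedBall_lt_top (μ := (volume : Measure E3)) (x := 0) (r := 1))).ne
    intro y hy
    simpa using hy.2
  · refine (ae_restrict_iff' (measurableSet_annulus ε)).mpr (.of_forall fun y hy => ?_)
    rw [Real.norm_eq_abs, ← one_div, le_div_iff₀ (by positivity)]
    refine le_trans ?_ (abs_dipole_mul_norm_pow_three_le y)
    have := hy.1.le
    gcongr

/-- The isometry of `ℝ³` permuting the coordinates cyclically. -/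
noncomputable def coordRotate : E3 ≃ₗᵢ[ℝ] E3 :=
  LinearIsometryEquiv.piLpCongrLeft 2 ℝ ℝ (finRotate 3)

lemma dipole_add_coordRotate (x : E3) :
    dipole x + dipole (coordRotate x) + dipole (coordRotate (coordRotate x)) = 0 := by
  have h0 (y : E3) : coordRotate y 0 = y 2 := rfl
  have h1 (y : E3) : coordRotate y 1 = y 0 := rfl
  have h2 (y : E3) : coordRotate y 2 = y 1 := rfl
  simp only [dipole, LinearIsometryEquiv.norm_map, h0, h1, h2]
  ring

lemma integral_indicator_annulus_dipole {ε : ℝ} (hε : 0 < ε) :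
    ∫ y, (annulus ε).indicator dipole y = 0 := by
  set h := (annulus ε).indicator dipole with hh
  have hi : Integrable h := integrable_indicator_annulus_dipole hε
  have mp : MeasurePreserving coordRotate := coordRotate.measurePreserving
  have me : MeasurableEmbedding coordRotate :=
    coordRotate.toHomeomorph.measurableEmbedding
  have e1 (g : E3 → ℝ) : ∫ y, g (coordRotate y) = ∫ y, g y := mp.integral_comp me g
  have i1 {g : E3 → ℝ} (hg : Integrable g) : Integrable fun y => g (coordRotate y) :=
    (mp.integrable_comp_emb me).mpr hg
  have key : ∫ y, (h y + h (coordRotate y) + h (coordRotate (coordRotate y))) = 0 := by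
    refine (integral_congr_ae (.of_forall fun y => ?_)).trans (integral_zero E3 ℝ)
    by_cases hy : ε < ‖y‖ ∧ ‖y‖ ≤ 1
    · simpa [hh, annulus, Set.indicator, hy] using dipole_add_coordRotate y
    · simp [hh, annulus, hy]
  have hi' : Integrable fun y => h y + h (coordRotate y) := hi.add (i1 hi)
  rw [integral_add hi' (i1 (i1 hi)), integral_add hi (i1 hi),
    e1 (fun y => h (coordRotate y)), e1 h] at key
  linarith

lemma integrable_indicator_inv_norm_sq (C : ℝ) :
    Integrable fun y : E3 => (Set.Iic (1 : ℝ)).indicator (fun r => C * (r ^ 2)⁻¹) ‖y‖ := by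
  rw [integrable_fun_norm_addHaar volume
    (f := (Set.Iic (1 : ℝ)).indicator (fun r => C * (r ^ 2)⁻¹))]
  have : IntegrableOn ((Set.Iic (1 : ℝ)).indicator fun _ => C) (Set.Ioi 0) := by
    rw [IntegrableOn, integrable_indicator_iff measurableSet_Iic, IntegrableOn,
      Measure.restrict_restrict measurableSet_Iic, Set.inter_comm, Set.Ioi_inter_Iic]
    exact integrableOn_const (by simp)
  refine this.congr_fun (fun r hr => ?_) measurableSet_Ioi
  have hr : r ≠ 0 := ne_of_gt hr
  by_cases h1 : r ≤ 1
  · simp [Set.indicator, h1]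
    field_simp
  · simp [Set.indicator, h1]

lemma exists_norm_schwartz_sub_le (χ : SchwartzMap E3 ℂ) :
    ∃ C : ℝ, ∀ x y : E3, ‖χ x - χ y‖ ≤ C * ‖x - y‖ := by
  obtain ⟨C, hC⟩ := χ.decay' 0 1
  refine ⟨C, fun x y => ?_⟩
  refine Convex.norm_image_sub_le_of_norm_fderiv_le (𝕜 := ℝ) (s := Set.univ)
    (fun z _ => χ.differentiable z) (fun z _ => ?_) convex_univ trivial trivial
  have hz : ‖z‖ ^ 0 * ‖iteratedFDeriv ℝ 1 χ z‖ ≤ C := hC z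
  simpa [norm_iteratedFDeriv_one] using hz

/-- The dipole kernel against `χ (x - ·)`, with its value at the pole subtracted on the
unit ball. -/
noncomputable def regularized (χ : SchwartzMap E3 ℂ) (x y : E3) : ℂ :=
  (dipole y : ℂ) * (χ (x - y) - if ‖y‖ ≤ 1 then χ x else 0)

lemma integrable_regularized (χ : SchwartzMap E3 ℂ) (x : E3) :
    Integrable (regularized χ x) := by
  obtain ⟨C, hC⟩ := exists_norm_schwartz_sub_le χ
  have hχ : Integrable fun y => ‖χ (x - y)‖ := (χ.integrable.comp_sub_left x).norm
  refine ((integrable_indicator_inv_norm_sq C).add hχ).mono' ?_ (.of_forall fun y => ?_)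
  · refine Measurable.aestronglyMeasurable ?_
    have := measurable_dipole
    have := χ.continuous.measurable
    refine Measurable.mul (by fun_prop) (Measurable.sub (by fun_prop) ?_)
    exact Measurable.ite (measurableSet_le measurable_norm measurable_const)
      measurable_const measurable_const
  · rcases eq_or_ne y 0 with rfl | hy
    · simp [regularized, dipole_zero, Set.indicator]
    have hn : 0 < ‖y‖ := norm_pos_iff.mpr hy
    have hd := abs_dipole_mul_norm_pow_three_le y
    by_cases h1 : ‖y‖ ≤ 1
    · have hl : ‖χ (x - y) - χ x‖ ≤ C * ‖y‖ := by simpa using hC (x - y) x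
      have hC0 : 0 ≤ C * ‖y‖ := (norm_nonneg _).trans hl
      have : ‖regularized χ x y‖ ≤ C * (‖y‖ ^ 2)⁻¹ := by
        simp only [regularized, h1, if_true, norm_mul, Complex.norm_real, Real.norm_eq_abs]
        calc |dipole y| * ‖χ (x - y) - χ x‖ ≤ (‖y‖ ^ 3)⁻¹ * (C * ‖y‖) := by
              gcongr
              rwa [← one_div, le_div_iff₀ (by positivity)]
          _ = C * (‖y‖ ^ 2)⁻¹ := by field_simp
      simp only [Pi.add_apply, Set.indicator, Set.mem_Iic, h1, if_true]
      linarith [norm_nonneg (χ (x - y))]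
    · have hd1 : |dipole y| ≤ 1 := by
        refine le_trans (le_mul_of_one_le_right (abs_nonneg _) ?_) hd
        exact one_le_pow₀ (not_le.mp h1).le
      simp only [Pi.add_apply, Set.indicator, Set.mem_Iic, h1, if_false, regularized, norm_mul,
        Complex.norm_real, Real.norm_eq_abs, sub_zero, zero_add]
      exact mul_le_of_le_one_left (norm_nonneg _) hd1

lemma integral_truncated_dipole (χ : SchwartzMap E3 ℂ) (x : E3) {ε : ℝ} (hε : 0 < ε) :
    ∫ x' in {x' : E3 | ε < ‖x - x'‖}, (dipole (x - x') : ℂ) * χ x' =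
      ∫ y, {y : E3 | ε < ‖y‖}.indicator (regularized χ x) y := by
  have hS : MeasurableSet {y : E3 | ε < ‖y‖} :=
    measurableSet_lt measurable_const measurable_norm
  have hS' : MeasurableSet {x' : E3 | ε < ‖x - x'‖} :=
    measurableSet_lt measurable_const (by fun_prop)
  have hA : Integrable fun y => (((annulus ε).indicator dipole y : ℝ) : ℂ) * χ x :=
    (integrable_indicator_annulus_dipole hε).ofReal.mul_const _
  have hz : ∫ y, (((annulus ε).indicator dipole y : ℝ) : ℂ) * χ x = 0 := by
    rw [integral_mul_const, integral_complex_ofReal, integral_indicator_annulus_dipole hε]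
    simp
  rw [← integral_indicator hS', ← integral_sub_left_eq_self _ volume x]
  rw [← add_zero (∫ y, Set.indicator _ (regularized χ x) y), ← hz,
    ← integral_add ((integrable_regularized χ x).indicator hS) hA]
  refine integral_congr_ae (.of_forall fun y => ?_)
  by_cases h1 : ε < ‖y‖ <;> by_cases h2 : ‖y‖ ≤ 1 <;>
    simp [Set.indicator, annulus, regularized, h1, h2, mul_sub]

/-- For every Schwartz function `χ` on `ℝ³` and every `x ∈ ℝ³`, the principal value
integral `lim_{ε→0⁺} ∫_{|x−x'|>ε} d(x−x') χ(x') dx'` exists (the limit is finite). -/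
theorem stmt2 (χ : SchwartzMap E3 ℂ) (x : E3) :
    ∃ L : ℂ,
      Tendsto (fun ε : ℝ =>
          ∫ x' in {x' : E3 | ε < ‖x - x'‖}, (dipole (x - x') : ℂ) * χ x')
        (nhdsWithin 0 (Set.Ioi 0)) (nhds L) := by
  refine ⟨∫ y, regularized χ x y, ?_⟩
  have hint := integrable_regularized χ x
  have key : Tendsto (fun ε : ℝ => ∫ y, {y : E3 | ε < ‖y‖}.indicator (regularized χ x) y)
      (nhdsWithin 0 (Set.Ioi 0)) (nhds (∫ y, regularized χ x y)) := by
    refine tendsto_integral_filter_of_dominated_convergence (fun y => ‖regularized χ x y‖)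
      (.of_forall fun ε => hint.aestronglyMeasurable.indicator
        (measurableSet_lt measurable_const measurable_norm))
      (.of_forall fun ε => .of_forall fun y => norm_indicator_le_norm_self _ _) hint.norm
      (.of_forall fun y => ?_)
    rcases eq_or_ne y 0 with rfl | hy
    · simp [Set.indicator, regularized, dipole_zero]
    · refine tendsto_const_nhds.congr' ?_
      filter_upwards [nhdsWithin_le_nhds (Iio_mem_nhds (norm_pos_iff.mpr hy))] with ε hε
      exact (Set.indicator_of_mem (s := {y : E3 | ε < ‖y‖}) hε _).symm
  refine key.congr' ?_
  filter_upwards [self_mem_nhdsWithin] with ε hε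
  exact (integral_truncated_dipole χ x hε).symm
end

section
/- The function g : ℝ³ → ℝ defined by g(x) = 3/(4π√(x₃² − 2(x₁² + x₂²))) when 2(x₁² + x₂²) < x₃² and g(x) = 0 otherwise, is locally integrable on ℝ³. -/
open MeasureTheory

/-- The fundamental solution kernel of the QSM wave-type operator. -/
noncomputable def gker (x : E3) : ℝ :=
  if 2 * ((x 0) ^ 2 + (x 1) ^ 2) < (x 2) ^ 2 then
    3 / (4 * Real.pi * Real.sqrt ((x 2) ^ 2 - 2 * ((x 0) ^ 2 + (x 1) ^ 2)))
  else 0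

/-- The arcsine density on `(-b, b)` has total mass `π`, whatever `b > 0` is. -/
theorem lintegral_one_div_sqrt_sq_sub_sq {b : ℝ} (hb : 0 < b) :
    ∫⁻ x in Set.Ioc (-b) b, ENNReal.ofReal (1 / Real.sqrt (b ^ 2 - x ^ 2)) =
      ENNReal.ofReal Real.pi := by
  have hab : -b ≤ b := by linarith
  have hcont : ContinuousOn (fun x => Real.arcsin (x / b)) (Set.Icc (-b) b) := by
    have := Real.continuous_arcsin
    fun_prop
  have hderiv : ∀ x ∈ Set.Ioo (-b) b,
      HasDerivAt (fun x => Real.arcsin (x / b)) (1 / Real.sqrt (b ^ 2 - x ^ 2)) x := by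
    intro x hx
    have h1 : x / b < 1 := by rw [div_lt_one hb]; exact hx.2
    have h2 : -1 < x / b := by rw [lt_div_iff₀ hb]; linarith [hx.1]
    refine ((Real.hasDerivAt_arcsin h2.ne' h1.ne).comp x
      ((hasDerivAt_id x).div_const b)).congr_deriv ?_
    have : b ^ 2 - x ^ 2 = b ^ 2 * (1 - (x / b) ^ 2) := by field_simp
    rw [this, Real.sqrt_mul (sq_nonneg b), Real.sqrt_sq hb.le]
    field_simp
  have hnonneg : ∀ x, 0 ≤ 1 / Real.sqrt (b ^ 2 - x ^ 2) := fun x => by positivity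
  have hint := intervalIntegral.integrableOn_deriv_of_nonneg hcont hderiv fun x _ => hnonneg x
  rw [← ofReal_integral_eq_lintegral_ofReal hint (ae_of_all _ hnonneg),
    ← intervalIntegral.integral_of_le hab,
    intervalIntegral.integral_eq_sub_of_hasDerivAt_of_le hab hcont hderiv
      ((intervalIntegrable_iff_integrableOn_Ioc_of_le hab).2 hint),
    neg_div, div_self hb.ne', Real.arcsin_one, Real.arcsin_neg_one]
  congr 1
  ring

/-- The integral of the kernel along each line parallel to the first axis is at most `1`. -/
theorem lintegral_ite_three_div_le_one (c : ℝ) :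
    ∫⁻ x : ℝ, ENNReal.ofReal
      (if 2 * x ^ 2 < c then 3 / (4 * Real.pi * Real.sqrt (c - 2 * x ^ 2)) else 0) ≤ 1 := by
  rcases le_or_gt c 0 with hc | hc
  · have h (x : ℝ) : ¬ 2 * x ^ 2 < c := by nlinarith [sq_nonneg x]
    simp [h]
  set b := Real.sqrt (c / 2) with hbdef
  have hb : 0 < b := Real.sqrt_pos.2 (by positivity)
  have hb2 : c = 2 * b ^ 2 := by rw [hbdef, Real.sq_sqrt (by positivity)]; ring
  calc
    _ ≤ ∫⁻ x, (Set.Ioc (-b) b).indicator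
        (fun x => ENNReal.ofReal (1 / Real.pi) *
          ENNReal.ofReal (1 / Real.sqrt (b ^ 2 - x ^ 2))) x := by
      refine lintegral_mono fun x => ?_
      split_ifs with h
      · have hx : |x| < b := abs_lt_of_sq_lt_sq (by linarith) hb.le
        rw [Set.indicator_of_mem (Set.mem_Ioc.2 ⟨(abs_lt.1 hx).1, (abs_lt.1 hx).2.le⟩),
          ← ENNReal.ofReal_mul (by positivity)]
        refine ENNReal.ofReal_le_ofReal ?_
        have hd : 0 < b ^ 2 - x ^ 2 := by linarith
        have hs := Real.sqrt_pos.2 hd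
        have hle : Real.sqrt (b ^ 2 - x ^ 2) ≤ Real.sqrt (c - 2 * x ^ 2) :=
          Real.sqrt_le_sqrt (by linarith)
        have hpi := Real.pi_pos
        rw [div_mul_div_comm, div_le_div_iff₀ (by positivity) (by positivity)]
        nlinarith [mul_le_mul_of_nonneg_left hle hpi.le, mul_pos hpi hs]
      · simp
    _ = 1 := by
      rw [lintegral_indicator measurableSet_Ioc,
        lintegral_const_mul' _ _ ENNReal.ofReal_ne_top, lintegral_one_div_sqrt_sq_sub_sq hb,
        ← ENNReal.ofReal_mul (by positivity), one_div_mul_cancel Real.pi_pos.ne',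
        ENNReal.ofReal_one]

theorem measurable_gker : Measurable gker := by
  unfold gker
  refine Measurable.ite (measurableSet_lt ?_ ?_) ?_ measurable_const <;> fun_prop

theorem gker_nonneg (x : E3) : 0 ≤ gker x := by
  unfold gker
  split_ifs <;> positivity

/-- The volume-preserving splitting of `ℝ³` into the first coordinate and the other two. -/
noncomputable def splitFirst : E3 ≃ᵐ ℝ × (Fin 2 → ℝ) :=
  (MeasurableEquiv.toLp 2 (Fin 3 → ℝ)).symm.trans
    (MeasurableEquiv.piFinSuccAbove (fun _ : Fin 3 => ℝ) 0)

theorem measurePreserving_splitFirst : MeasurePreserving splitFirst :=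
  (volume_preserving_piFinSuccAbove (fun _ : Fin 3 => ℝ) 0).comp
    (PiLp.volume_preserving_ofLp (Fin 3))

theorem gker_splitFirst_symm (p : ℝ × (Fin 2 → ℝ)) :
    gker (splitFirst.symm p) =
      if 2 * p.1 ^ 2 < p.2 1 ^ 2 - 2 * p.2 0 ^ 2 then
        3 / (4 * Real.pi * Real.sqrt (p.2 1 ^ 2 - 2 * p.2 0 ^ 2 - 2 * p.1 ^ 2)) else 0 := by
  have h0 : splitFirst.symm p 0 = p.1 := rfl
  have h1 : splitFirst.symm p 1 = p.2 0 := rfl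
  have h2 : splitFirst.symm p 2 = p.2 1 := rfl
  have hd : p.2 1 ^ 2 - 2 * (p.1 ^ 2 + p.2 0 ^ 2) = p.2 1 ^ 2 - 2 * p.2 0 ^ 2 - 2 * p.1 ^ 2 := by
    ring
  have hlt : 2 * (p.1 ^ 2 + p.2 0 ^ 2) < p.2 1 ^ 2 ↔ 2 * p.1 ^ 2 < p.2 1 ^ 2 - 2 * p.2 0 ^ 2 := by
    constructor <;> intro h <;> linarith
  simp only [gker, h0, h1, h2, hd, hlt]

/-- The integral of the kernel over a cylinder along the first axis is at most the area of the
base. -/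
theorem setLIntegral_gker_splitFirst_preimage_le (s : Set (Fin 2 → ℝ)) :
    ∫⁻ x in splitFirst ⁻¹' (Set.univ ×ˢ s), ENNReal.ofReal (gker x) ≤ volume s := by
  have hm : Measurable fun p => ENNReal.ofReal (gker (splitFirst.symm p)) :=
    (measurable_gker.comp splitFirst.symm.measurable).ennreal_ofReal
  calc
    _ = ∫⁻ p in Set.univ ×ˢ s, ENNReal.ofReal (gker (splitFirst.symm p)) := by
      rw [← measurePreserving_splitFirst.setLIntegral_comp_preimage_emb
        splitFirst.measurableEmbedding]
      simp
    _ = ∫⁻ y in s, ∫⁻ x, ENNReal.ofReal (gker (splitFirst.symm (x, y))) := by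
      rw [Measure.volume_eq_prod, ← Measure.prod_restrict, Measure.restrict_univ,
        lintegral_prod_symm _ hm.aemeasurable]
    _ ≤ ∫⁻ _ in s, 1 := by
      refine lintegral_mono fun y => ?_
      simp only [gker_splitFirst_symm]
      exact lintegral_ite_three_div_le_one _
    _ = volume s := by simp

/-- The fundamental solution kernel `g` is locally integrable on `ℝ³`. -/
theorem stmt4 : LocallyIntegrable gker (volume : Measure E3) := by
  rw [locallyIntegrable_iff]
  intro K hK
  have hcont : Continuous fun x : E3 => (splitFirst x).2 := by
    change Continuous fun x : E3 => fun i : Fin 2 => x ((0 : Fin 3).succAbove i)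
    fun_prop
  refine ⟨measurable_gker.aestronglyMeasurable, ?_⟩
  rw [hasFiniteIntegral_iff_ofReal (ae_of_all _ gker_nonneg)]
  calc
    _ ≤ ∫⁻ x in splitFirst ⁻¹' (Set.univ ×ˢ ((fun x => (splitFirst x).2) '' K)),
        ENNReal.ofReal (gker x) :=
      lintegral_mono_set fun x hx => ⟨trivial, x, hx, rfl⟩
    _ ≤ volume ((fun x => (splitFirst x).2) '' K) := setLIntegral_gker_splitFirst_preimage_le _
    _ < ⊤ := (hK.image hcont).measure_lt_top
end

section
/- Let g : ℝ³ → ℝ be defined by g(x) = 3/(4π√(x₃² − 2(x₁² + x₂²))) when 2(x₁² + x₂²) < x₃² and g(x) = 0 otherwise. For every point x₀ ≠ 0 on the cone {x ∈ ℝ³ : x₃² = 2(x₁² + x₂²)} and every open neighborhood U of x₀, the function g is unbounded on U. Consequently the singular support of g contains the cone {x : x₃² = 2(x₁² + x₂²)} \ {0}. -/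
open MeasureTheory

open Filter Topology

/-- The quadratic form whose zero set is the cone and whose positive set carries `gker`. -/
def coneForm (x : E3) : ℝ := (x 2) ^ 2 - 2 * ((x 0) ^ 2 + (x 1) ^ 2)

lemma continuous_coneForm : Continuous coneForm := by
  unfold coneForm
  fun_prop

lemma apply_two_ne_zero_of_mem_cone {x₀ : E3} (hx₀ : x₀ ≠ 0)
    (hcone : (x₀ 2) ^ 2 = 2 * ((x₀ 0) ^ 2 + (x₀ 1) ^ 2)) : x₀ 2 ≠ 0 := by
  intro h2
  rw [h2] at hcone
  have h0 : x₀ 0 = 0 := by nlinarith [sq_nonneg (x₀ 0), sq_nonneg (x₀ 1)]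
  have h1 : x₀ 1 = 0 := by nlinarith [sq_nonneg (x₀ 0), sq_nonneg (x₀ 1)]
  apply hx₀
  ext i
  fin_cases i <;> simp [h0, h1, h2]

lemma mem_closure_coneForm_mem_Ioo {x₀ : E3} (hx₀ : x₀ ≠ 0)
    (hcone : (x₀ 2) ^ 2 = 2 * ((x₀ 0) ^ 2 + (x₀ 1) ^ 2)) {δ : ℝ} (hδ : 0 < δ) :
    x₀ ∈ closure (coneForm ⁻¹' Set.Ioo 0 δ) := by
  have h2 := apply_two_ne_zero_of_mem_cone hx₀ hcone
  let p : ℝ → E3 := fun t => x₀ + t • EuclideanSpace.single 2 (x₀ 2)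
  have hp : Tendsto p (𝓝[>] 0) (𝓝 x₀) := by
    have hc : Continuous p := by fun_prop
    simpa [p] using (hc.tendsto 0).mono_left nhdsWithin_le_nhds
  have hlt : ∀ᶠ t in 𝓝[>] 0, coneForm (p t) < δ := by
    refine ((continuous_coneForm.tendsto x₀).comp hp).eventually_lt_const ?_
    rwa [coneForm, hcone, sub_self]
  refine mem_closure_of_tendsto hp ?_
  filter_upwards [hlt, self_mem_nhdsWithin] with t ht ht0
  refine ⟨?_, ht⟩
  have ht0 : 0 < t := ht0
  have hq : coneForm (p t) = (x₀ 2) ^ 2 * (t * (2 + t)) := by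
    simp [coneForm, p]
    linear_combination hcone
  rw [hq]
  positivity

lemma exists_forall_lt_gker (M : ℝ) :
    ∃ δ > 0, ∀ x, coneForm x ∈ Set.Ioo 0 δ → M < gker x := by
  have hK : 0 < 4 * Real.pi * (|M| + 1) := by positivity
  refine ⟨(3 / (4 * Real.pi * (|M| + 1))) ^ 2, by positivity, fun x hx => ?_⟩
  have hpos : 2 * ((x 0) ^ 2 + (x 1) ^ 2) < (x 2) ^ 2 := sub_pos.1 hx.1
  have hs : √(coneForm x) < 3 / (4 * Real.pi * (|M| + 1)) :=
    (Real.sqrt_lt' (by positivity)).2 hx.2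
  have hs0 : 0 < √(coneForm x) := Real.sqrt_pos.2 hx.1
  rw [gker, if_pos hpos]
  change M < 3 / (4 * Real.pi * √(coneForm x))
  rw [lt_div_iff₀ hK] at hs
  refine (le_abs_self M).trans_lt ((lt_add_one _).trans ?_)
  rw [lt_div_iff₀ (by positivity)]
  linarith

lemma exists_isOpen_forall_lt_gker {x₀ : E3} (hx₀ : x₀ ≠ 0)
    (hcone : (x₀ 2) ^ 2 = 2 * ((x₀ 0) ^ 2 + (x₀ 1) ^ 2)) (M : ℝ) :
    ∃ W : Set E3, IsOpen W ∧ x₀ ∈ closure W ∧ ∀ x ∈ W, M < gker x := by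
  obtain ⟨δ, hδ, h⟩ := exists_forall_lt_gker M
  exact ⟨_, isOpen_Ioo.preimage continuous_coneForm,
    mem_closure_coneForm_mem_Ioo hx₀ hcone hδ, h⟩

/-- At every nonzero point of the cone `{x : x₃² = 2(x₁² + x₂²)}`, the kernel `g` is
unbounded on every open neighborhood; consequently no such point has a neighborhood on
which `g` agrees a.e. with a `C^∞` function, i.e. the singular support of `g` contains
the cone minus the origin. -/
theorem stmt6 (x₀ : E3) (hx₀ : x₀ ≠ 0) (hcone : (x₀ 2) ^ 2 = 2 * ((x₀ 0) ^ 2 + (x₀ 1) ^ 2)) :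
    (∀ U : Set E3, IsOpen U → x₀ ∈ U → ∀ M : ℝ, ∃ x ∈ U, M < gker x) ∧
      ¬∃ U : Set E3, IsOpen U ∧ x₀ ∈ U ∧
        ∃ h : E3 → ℝ, ContDiffOn ℝ (⊤ : ℕ∞) h U ∧
          gker =ᵐ[(volume : Measure E3).restrict U] h := by
  constructor
  · intro U hU hxU M
    obtain ⟨W, -, hxW, hW⟩ := exists_isOpen_forall_lt_gker hx₀ hcone M
    obtain ⟨x, hx, hxW⟩ := mem_closure_iff.1 hxW U hU hxU
    exact ⟨x, hx, hW x hxW⟩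
  · rintro ⟨U, hU, hxU, h, hh, hae⟩
    obtain ⟨W, hWo, hxW, hW⟩ := exists_isOpen_forall_lt_gker hx₀ hcone (h x₀ + 1)
    have hV : IsOpen (U ∩ h ⁻¹' Set.Iio (h x₀ + 1)) :=
      hh.continuousOn.isOpen_inter_preimage hU isOpen_Iio
    have hne := mem_closure_iff.1 hxW _ hV ⟨hxU, lt_add_one (h x₀)⟩
    refine ((hV.inter hWo).measure_pos volume hne).ne' ?_
    rw [EventuallyEq, ae_restrict_iff' hU.measurableSet] at hae
    refine measure_mono_null ?_ (ae_iff.1 hae)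
    rintro x ⟨⟨hx, hlt⟩, hxW⟩ heq
    exact ((hW x hxW).trans_eq (heq hx)).not_gt hlt
end

section
/- Let g : ℝ³ → ℝ be defined by g(x) = 3/(4π√(x₃² − 2(x₁² + x₂²))) when 2(x₁² + x₂²) < x₃² and g(x) = 0 otherwise. Then g is a fundamental solution of the wave-type operator P(∂) = (2/3)∂²/∂x₃² − (1/3)(∂²/∂x₁² + ∂²/∂x₂²): for every smooth compactly supported function φ : ℝ³ → ℝ, ∫_{ℝ³} g(x) · (P(∂)φ)(x) dx = φ(0). -/
open MeasureTheory

/-- Second partial derivative in the `i`-th coordinate direction. -/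
noncomputable def pd2 (i : Fin 3) (f : E3 → ℝ) (x : E3) : ℝ :=
  fderiv ℝ (fun y => fderiv ℝ f y (EuclideanSpace.single i (1 : ℝ))) x
    (EuclideanSpace.single i (1 : ℝ))

/-- The QSM wave-type operator `P(∂) = (2/3)∂₃² − (1/3)(∂₁² + ∂₂²)`. -/
noncomputable def Pop (f : E3 → ℝ) (x : E3) : ℝ :=
  (2 / 3 : ℝ) * pd2 2 f x - (1 / 3 : ℝ) * (pd2 0 f x + pd2 1 f x)

open Real in
/-- Cone coordinates `(t, α, θ)`: at height `t`, the radius is `t sin α / √2`. -/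
noncomputable def coneMap (p : Fin 3 → ℝ) : Fin 3 → ℝ :=
  ![(√2)⁻¹ * p 0 * sin (p 1) * cos (p 2), (√2)⁻¹ * p 0 * sin (p 1) * sin (p 2), p 0]

/-- First partial derivative in the `i`-th coordinate direction. -/
noncomputable def pd1 (i : Fin 3) (f : E3 → ℝ) (x : E3) : ℝ :=
  fderiv ℝ f x (EuclideanSpace.single i (1 : ℝ))

lemma pd2_eq_pd1_pd1 (i : Fin 3) (f : E3 → ℝ) : pd2 i f = pd1 i (pd1 i f) := rfl

lemma contDiff_pd1 {f : E3 → ℝ} (hf : ContDiff ℝ (⊤ : ℕ∞) f) (i : Fin 3) :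
    ContDiff ℝ (⊤ : ℕ∞) (pd1 i f) := by
  have h : ContDiff ℝ (⊤ : ℕ∞) (fderiv ℝ f) := hf.fderiv_right (by simp)
  exact h.clm_apply contDiff_const

lemma pd1_comm {f : E3 → ℝ} (hf : ContDiff ℝ (⊤ : ℕ∞) f) (i j : Fin 3) (x : E3) :
    pd1 i (pd1 j f) x = pd1 j (pd1 i f) x := by
  have h : ContDiff ℝ (⊤ : ℕ∞) (fderiv ℝ f) := hf.fderiv_right (by simp)
  have hd : DifferentiableAt ℝ (fderiv ℝ f) x := h.differentiable (by simp) x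
  have hs : IsSymmSndFDerivAt ℝ f x := hf.contDiffAt.isSymmSndFDerivAt 
    (by simpa using WithTop.coe_le_coe.2 (le_top : (2 : ℕ∞) ≤ ⊤))
  have key : ∀ k l : Fin 3, pd1 k (pd1 l f) x =
      fderiv ℝ (fderiv ℝ f) x (EuclideanSpace.single k 1) (EuclideanSpace.single l 1) := by
    intro k l
    unfold pd1
    rw [fderiv_clm_apply hd (by fun_prop)]
    simp
  rw [key, key, hs.eq]

lemma pd1_eq_zero_of_notMem_tsupport {f : E3 → ℝ} {x : E3} (hx : x ∉ tsupport f) (i : Fin 3) :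
    pd1 i f x = 0 := by
  unfold pd1
  rw [image_eq_zero_of_notMem_tsupport (fun h => hx (tsupport_fderiv_subset ℝ h))]
  rfl

lemma tsupport_pd1_subset (f : E3 → ℝ) (i : Fin 3) : tsupport (pd1 i f) ⊆ tsupport f :=
  closure_minimal (fun x hx => by
    by_contra h
    exact hx (pd1_eq_zero_of_notMem_tsupport h i)) (isClosed_tsupport f)

lemma hasDerivAt_comp_curve {f : E3 → ℝ} (hf : Differentiable ℝ f) {u : ℝ → Fin 3 → ℝ}
    {u' : Fin 3 → ℝ} {s : ℝ} (hu : HasDerivAt u u' s) :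
    HasDerivAt (fun r => f (WithLp.toLp 2 (u r)))
      (u' 0 * pd1 0 f (WithLp.toLp 2 (u s)) + u' 1 * pd1 1 f (WithLp.toLp 2 (u s)) +
        u' 2 * pd1 2 f (WithLp.toLp 2 (u s))) s := by
  have h1 : HasDerivAt (fun r => WithLp.toLp 2 (u r)) (WithLp.toLp 2 u') s :=
    ((PiLp.continuousLinearEquiv 2 ℝ (fun _ : Fin 3 => ℝ)).symm :
      (Fin 3 → ℝ) →L[ℝ] E3).hasFDerivAt.comp_hasDerivAt s hu
  have h2 := (hf (WithLp.toLp 2 (u s))).hasFDerivAt.comp_hasDerivAt s h1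
  convert! h2 using 1
  have : WithLp.toLp 2 u' = u' 0 • EuclideanSpace.single 0 (1 : ℝ) +
      u' 1 • EuclideanSpace.single 1 (1 : ℝ) + u' 2 • EuclideanSpace.single (2 : Fin 3) (1 : ℝ) := by
    ext i; fin_cases i <;> simp
  rw [this]
  simp [pd1]

lemma contDiff_coneMap : ContDiff ℝ (⊤ : ℕ∞) coneMap := by
  rw [contDiff_pi]
  intro i
  fin_cases i <;> simp only [coneMap] <;> simp <;> fun_prop

lemma contDiff_comp_coneMap {f : E3 → ℝ} (hf : ContDiff ℝ (⊤ : ℕ∞) f) :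
    ContDiff ℝ (⊤ : ℕ∞) (fun p => f (WithLp.toLp 2 (coneMap p))) :=
  hf.comp ((PiLp.continuousLinearEquiv 2 ℝ (fun _ : Fin 3 => ℝ)).symm.contDiff.comp
    contDiff_coneMap)

open Real in
lemma hasDerivAt_coneMap_zero (p : Fin 3 → ℝ) :
    HasDerivAt (fun s => coneMap (Function.update p 0 s))
      ![(√2)⁻¹ * sin (p 1) * cos (p 2), (√2)⁻¹ * sin (p 1) * sin (p 2), 1] (p 0) := by
  rw [hasDerivAt_pi]
  have h := hasDerivAt_id (p 0)
  intro i
  fin_cases i <;> simp [coneMap]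
  · convert! ((h.const_mul (√2)⁻¹).mul_const (sin (p 1))).mul_const (cos (p 2)) using 1; ring
  · convert! ((h.const_mul (√2)⁻¹).mul_const (sin (p 1))).mul_const (sin (p 2)) using 1; ring
  · exact h

open Real in
lemma hasDerivAt_coneMap_one (p : Fin 3 → ℝ) :
    HasDerivAt (fun s => coneMap (Function.update p 1 s))
      ![(√2)⁻¹ * p 0 * cos (p 1) * cos (p 2), (√2)⁻¹ * p 0 * cos (p 1) * sin (p 2), 0] (p 1) := by
  rw [hasDerivAt_pi]
  have h := hasDerivAt_sin (p 1)
  intro i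
  fin_cases i <;> simp [coneMap]
  · exact (h.const_mul ((√2)⁻¹ * p 0)).mul_const (cos (p 2))
  · exact (h.const_mul ((√2)⁻¹ * p 0)).mul_const (sin (p 2))
  · exact hasDerivAt_const _ _

open Real in
lemma hasDerivAt_coneMap_two (p : Fin 3 → ℝ) :
    HasDerivAt (fun s => coneMap (Function.update p 2 s))
      ![-((√2)⁻¹ * p 0 * sin (p 1) * sin (p 2)), (√2)⁻¹ * p 0 * sin (p 1) * cos (p 2), 0]
      (p 2) := by
  rw [hasDerivAt_pi]
  intro i
  fin_cases i <;> simp [coneMap]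
  · convert! (hasDerivAt_cos (p 2)).const_mul ((√2)⁻¹ * p 0 * sin (p 1)) using 1; ring
  · exact (hasDerivAt_sin (p 2)).const_mul ((√2)⁻¹ * p 0 * sin (p 1))
  · exact hasDerivAt_const _ _

lemma fderiv_single_eq_of_hasDerivAt_update {F : Type*} [NormedAddCommGroup F] [NormedSpace ℝ F]
    {f : (Fin 3 → ℝ) → F} {p : Fin 3 → ℝ} {j : Fin 3} {d : F} (hf : DifferentiableAt ℝ f p)
    (h : HasDerivAt (fun s => f (Function.update p j s)) d (p j)) :
    fderiv ℝ f p (Pi.single j 1) = d := by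
  have h1 := hasDerivAt_update p j (p j)
  have h2 : HasFDerivAt f (fderiv ℝ f p) (Function.update p j (p j)) := by
    simpa using hf.hasFDerivAt
  exact (h2.comp_hasDerivAt (p j) h1).unique h

section WaveField
open Real

/-- A vector field in cone coordinates whose divergence is `t sin α (∂₃² - (∂₁² + ∂₂²) / 2) φ`. -/
noncomputable def waveField (φ : E3 → ℝ) : Fin 3 → (Fin 3 → ℝ) → ℝ :=
  ![fun p => sin (p 1) * (p 0 * pd1 2 φ (WithLp.toLp 2 (coneMap p)) -
      φ (WithLp.toLp 2 (coneMap p)) - (√2)⁻¹ * p 0 * sin (p 1) *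
        (cos (p 2) * pd1 0 φ (WithLp.toLp 2 (coneMap p)) +
          sin (p 2) * pd1 1 φ (WithLp.toLp 2 (coneMap p)))),
    fun p => -((√2)⁻¹ * (sin (p 1) * cos (p 1)) *
      (cos (p 2) * pd1 0 φ (WithLp.toLp 2 (coneMap p)) +
        sin (p 2) * pd1 1 φ (WithLp.toLp 2 (coneMap p)))),
    fun p => -((√2)⁻¹ * (cos (p 2) * pd1 1 φ (WithLp.toLp 2 (coneMap p)) -
        sin (p 2) * pd1 0 φ (WithLp.toLp 2 (coneMap p))))]

lemma contDiff_waveField {φ : E3 → ℝ} (hφ : ContDiff ℝ (⊤ : ℕ∞) φ) (i : Fin 3) :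
    ContDiff ℝ (⊤ : ℕ∞) (waveField φ i) := by
  have h := contDiff_comp_coneMap hφ
  have h0 := contDiff_comp_coneMap (contDiff_pd1 hφ 0)
  have h1 := contDiff_comp_coneMap (contDiff_pd1 hφ 1)
  have h2 := contDiff_comp_coneMap (contDiff_pd1 hφ 2)
  have hs (j : Fin 3) : ContDiff ℝ (⊤ : ℕ∞) fun p : Fin 3 → ℝ => sin (p j) := by fun_prop
  have hk (j : Fin 3) : ContDiff ℝ (⊤ : ℕ∞) fun p : Fin 3 → ℝ => cos (p j) := by fun_prop
  have ht : ContDiff ℝ (⊤ : ℕ∞) fun p : Fin 3 → ℝ => p 0 := by fun_prop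
  have hr : ContDiff ℝ (⊤ : ℕ∞) fun _ : Fin 3 → ℝ => (√2)⁻¹ := contDiff_const
  have hρ := ((hk 2).mul h0).add ((hs 2).mul h1)
  fin_cases i
  · exact (hs 1).mul (((ht.mul h2).sub h).sub (((hr.mul ht).mul (hs 1)).mul hρ))
  · exact ((hr.mul ((hs 1).mul (hk 1))).mul hρ).neg
  · exact (hr.mul (((hk 2).mul h1).sub ((hs 2).mul h0))).neg

lemma divergence_waveField {φ : E3 → ℝ} (hφ : ContDiff ℝ (⊤ : ℕ∞) φ) (p : Fin 3 → ℝ) :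
    ∑ i, fderiv ℝ (waveField φ i) p (Pi.single i 1) =
      3 / 2 * (p 0 * sin (p 1)) * Pop φ (WithLp.toLp 2 (coneMap p)) := by
  have hd : ∀ f : E3 → ℝ, ContDiff ℝ (⊤ : ℕ∞) f → Differentiable ℝ f :=
    fun f hf => hf.differentiable (by simp)
  have hF : ∀ i, DifferentiableAt ℝ (waveField φ i) p :=
    fun i => (contDiff_waveField hφ i).differentiable (by simp) p
  have d1 : ∀ i, Differentiable ℝ (pd1 i φ) := fun i => hd _ (contDiff_pd1 hφ i)
  have a := hasDerivAt_comp_curve (hd φ hφ) (hasDerivAt_coneMap_zero p)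
  have a0 := hasDerivAt_comp_curve (d1 0) (hasDerivAt_coneMap_zero p)
  have a1 := hasDerivAt_comp_curve (d1 1) (hasDerivAt_coneMap_zero p)
  have a2 := hasDerivAt_comp_curve (d1 2) (hasDerivAt_coneMap_zero p)
  have b0 := hasDerivAt_comp_curve (d1 0) (hasDerivAt_coneMap_one p)
  have b1 := hasDerivAt_comp_curve (d1 1) (hasDerivAt_coneMap_one p)
  have c0 := hasDerivAt_comp_curve (d1 0) (hasDerivAt_coneMap_two p)
  have c1 := hasDerivAt_comp_curve (d1 1) (hasDerivAt_coneMap_two p)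
  simp only [Function.update_eq_self] at a a0 a1 a2 b0 b1 c0 c1
  have hid := hasDerivAt_id (p 0)
  have A := (((hid.mul a2).sub a).sub (((hid.const_mul (√2)⁻¹).mul_const (sin (p 1))).mul
    ((a0.const_mul (cos (p 2))).add (a1.const_mul (sin (p 2)))))).const_mul (sin (p 1))
  have B := ((((hasDerivAt_sin (p 1)).mul (hasDerivAt_cos (p 1))).const_mul (√2)⁻¹).mul
    ((b0.const_mul (cos (p 2))).add (b1.const_mul (sin (p 2))))).neg
  have C := ((((hasDerivAt_cos (p 2)).mul c1).sub
    ((hasDerivAt_sin (p 2)).mul c0)).const_mul (√2)⁻¹).neg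
  have eA := fderiv_single_eq_of_hasDerivAt_update (f := waveField φ 0) (j := 0) (hF 0)
    (by convert! A using 1)
  have eB := fderiv_single_eq_of_hasDerivAt_update (f := waveField φ 1) (j := 1) (hF 1)
    (by convert! B using 1)
  have eC := fderiv_single_eq_of_hasDerivAt_update (f := waveField φ 2) (j := 2) (hF 2)
    (by convert! C using 1)
  rw [Fin.sum_univ_three, eA, eB, eC, Pop, pd2_eq_pd1_pd1, pd2_eq_pd1_pd1, pd2_eq_pd1_pd1,
    pd1_comm hφ 0 2, pd1_comm hφ 1 2, pd1_comm hφ 1 0]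
  have hc : ((√2)⁻¹) ^ 2 = 1 / 2 := by simp
  simp only [Function.update_eq_self, Pi.mul_apply, Pi.add_apply, id_eq, Matrix.cons_val]
  generalize (√2)⁻¹ = c at *
  have h1 := sin_sq_add_cos_sq (p 1)
  have h2 := sin_sq_add_cos_sq (p 2)
  generalize sin (p 1) = s1 at *
  generalize cos (p 1) = k1 at *
  generalize sin (p 2) = s2 at *
  generalize cos (p 2) = k2 at *
  clear * - hc h1 h2
  grind

lemma integrableOn_divergence_waveField {φ : E3 → ℝ} (hφ : ContDiff ℝ (⊤ : ℕ∞) φ)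
    (a b : Fin 3 → ℝ) :
    IntegrableOn (fun p => 3 / 2 * (p 0 * sin (p 1)) * Pop φ (WithLp.toLp 2 (coneMap p)))
      (Set.Icc a b) := by
  have h (i : Fin 3) : Continuous fun p => pd1 i (pd1 i φ) (WithLp.toLp 2 (coneMap p)) :=
    (contDiff_comp_coneMap (contDiff_pd1 (contDiff_pd1 hφ i) i)).continuous
  have hP : Continuous fun p => Pop φ (WithLp.toLp 2 (coneMap p)) :=
    ((h 2).const_mul _).sub (((h 0).add (h 1)).const_mul _)
  exact (((by fun_prop : Continuous fun p : Fin 3 → ℝ => 3 / 2 * (p 0 * sin (p 1))).mul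
    hP).continuousOn).integrableOn_compact isCompact_Icc

lemma integral_divergence_waveField {φ : E3 → ℝ} (hφ : ContDiff ℝ (⊤ : ℕ∞) φ) {a b : ℝ}
    (hab : a ≤ b) :
    ∫ p in Set.Icc ![a, 0, -π] ![b, π / 2, π],
        3 / 2 * (p 0 * sin (p 1)) * Pop φ (WithLp.toLp 2 (coneMap p)) =
      (∫ q in Set.Icc ![0, -π] ![π / 2, π], waveField φ 0 ![b, q 0, q 1]) -
        ∫ q in Set.Icc ![0, -π] ![π / 2, π], waveField φ 0 ![a, q 0, q 1] := by
  have hle : ![a, 0, -π] ≤ ![b, π / 2, π] := by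
    intro i
    fin_cases i <;> simp <;> linarith [pi_pos]
  have key := integral_divergence_of_hasFDerivAt_off_countable' ![a, 0, -π] ![b, π / 2, π] hle
    (waveField φ) (fun i => fderiv ℝ (waveField φ i)) ∅ Set.countable_empty
    (fun i => (contDiff_waveField hφ i).continuous.continuousOn)
    (fun p _ i => ((contDiff_waveField hφ i).differentiable (by simp) p).hasFDerivAt)
    (by simpa only [divergence_waveField hφ] using integrableOn_divergence_waveField hφ _ _)
  simp only [divergence_waveField hφ] at key
  rw [key, Fin.sum_univ_three]
  have e0 (f : (Fin 3 → ℝ) → ℝ) (s : ℝ) : (fun q : Fin 2 → ℝ => f ((0 : Fin 3).insertNth s q)) =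
      fun q => f ![s, q 0, q 1] := by
    ext q; congr 1; ext i; fin_cases i <;> rfl
  have e1 (f : (Fin 3 → ℝ) → ℝ) (s : ℝ) : (fun q : Fin 2 → ℝ => f ((1 : Fin 3).insertNth s q)) =
      fun q => f ![q 0, s, q 1] := by
    ext q; congr 1; ext i; fin_cases i <;> rfl
  have e2 (f : (Fin 3 → ℝ) → ℝ) (s : ℝ) : (fun q : Fin 2 → ℝ => f ((2 : Fin 3).insertNth s q)) =
      fun q => f ![q 0, q 1, s] := by
    ext q; congr 1; ext i; fin_cases i <;> rfl
  have c0 (x y z : ℝ) : ![x, y, z] ∘ (0 : Fin 3).succAbove = ![y, z] := by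
    ext i; fin_cases i <;> rfl
  rw [e0, e0, e1, e1, e2, e2, c0, c0]
  simp [waveField, coneMap]

lemma waveField_zero_height (φ : E3 → ℝ) (q : Fin 2 → ℝ) :
    waveField φ 0 ![0, q 0, q 1] = -φ 0 * sin (q 0) := by
  have h : coneMap ![0, q 0, q 1] = 0 := by
    ext i; fin_cases i <;> simp [coneMap]
  simp [waveField, h, mul_comm]

lemma waveField_eq_zero {φ : E3 → ℝ} {p : Fin 3 → ℝ}
    (hp : WithLp.toLp 2 (coneMap p) ∉ tsupport φ) : waveField φ 0 p = 0 := by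
  simp [waveField, pd1_eq_zero_of_notMem_tsupport hp, image_eq_zero_of_notMem_tsupport hp]

lemma integral_Icc_sin_fst :
    ∫ q in Set.Icc ![0, -π] ![π / 2, π], sin (q 0) = 2 * π := by
  have hset : Set.Icc ![0, -π] ![π / 2, π] =
      MeasurableEquiv.finTwoArrow ⁻¹' (Set.Icc 0 (π / 2) ×ˢ Set.Icc (-π) π) := by
    ext q
    simp [Pi.le_def, Fin.forall_fin_two]
  have h := (volume_preserving_finTwoArrow ℝ).setIntegral_preimage_emb
    MeasurableEquiv.finTwoArrow.measurableEmbedding (fun z => sin z.1 * 1)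
    (Set.Icc 0 (π / 2) ×ˢ Set.Icc (-π) π)
  rw [← hset, Measure.volume_eq_prod, setIntegral_prod_mul sin fun _ => (1 : ℝ),
    integral_Icc_eq_integral_Ioc (x := (0 : ℝ)),
    ← intervalIntegral.integral_of_le (by positivity), integral_sin] at h
  simp [pi_pos.le] at h
  rw [h]
  ring

lemma integral_sin_mul_Pop_pos {φ : E3 → ℝ} (hφ : ContDiff ℝ (⊤ : ℕ∞) φ) {R : ℝ} (hR : 0 ≤ R)
    (hsupp : ∀ x ∈ tsupport φ, |x 2| < R) :
    ∫ p in Set.Icc ![0, 0, -π] ![R, π / 2, π],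
      3 / 2 * (p 0 * sin (p 1)) * Pop φ (WithLp.toLp 2 (coneMap p)) = 2 * π * φ 0 := by
  have h (q : Fin 2 → ℝ) : waveField φ 0 ![R, q 0, q 1] = 0 :=
    waveField_eq_zero fun h => by simpa [coneMap, abs_of_nonneg hR] using hsupp _ h
  simp only [integral_divergence_waveField hφ hR, h, waveField_zero_height, integral_const_mul,
    integral_Icc_sin_fst]
  simp
  ring

lemma integral_sin_mul_Pop_neg {φ : E3 → ℝ} (hφ : ContDiff ℝ (⊤ : ℕ∞) φ) {R : ℝ} (hR : 0 ≤ R)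
    (hsupp : ∀ x ∈ tsupport φ, |x 2| < R) :
    ∫ p in Set.Icc ![-R, 0, -π] ![0, π / 2, π],
      3 / 2 * (p 0 * sin (p 1)) * Pop φ (WithLp.toLp 2 (coneMap p)) = -(2 * π * φ 0) := by
  have h (q : Fin 2 → ℝ) : waveField φ 0 ![-R, q 0, q 1] = 0 :=
    waveField_eq_zero fun h => by simpa [coneMap, abs_of_nonneg hR] using hsupp _ h
  simp only [integral_divergence_waveField hφ (neg_nonpos.2 hR), h, waveField_zero_height,
    integral_const_mul, integral_Icc_sin_fst]
  simp
  ring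

lemma Pop_eq_zero_of_notMem_tsupport {φ : E3 → ℝ} {x : E3} (hx : x ∉ tsupport φ) :
    Pop φ x = 0 := by
  have h (i : Fin 3) : pd2 i φ x = 0 :=
    pd1_eq_zero_of_notMem_tsupport (fun h => hx (tsupport_pd1_subset φ i h)) i
  simp [Pop, h]

end WaveField

section ChangeOfVariables
open Real

lemma det_fderiv_coneMap (p : Fin 3 → ℝ) :
    (fderiv ℝ coneMap p).det = 1 / 2 * p 0 ^ 2 * (sin (p 1) * cos (p 1)) := by
  have hd : DifferentiableAt ℝ coneMap p := contDiff_coneMap.differentiable (by simp) p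
  have h0 := fderiv_single_eq_of_hasDerivAt_update hd (hasDerivAt_coneMap_zero p)
  have h1 := fderiv_single_eq_of_hasDerivAt_update hd (hasDerivAt_coneMap_one p)
  have h2 := fderiv_single_eq_of_hasDerivAt_update hd (hasDerivAt_coneMap_two p)
  have hc : ((√2)⁻¹) ^ 2 = 1 / 2 := by simp
  rw [ContinuousLinearMap.det, ← LinearMap.det_toMatrix', Matrix.det_fin_three]
  simp only [LinearMap.toMatrix'_apply, ContinuousLinearMap.coe_coe, h0, h1, h2, Matrix.cons_val]
  have hsc := sin_sq_add_cos_sq (p 2)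
  generalize (√2)⁻¹ = c at *
  generalize sin (p 2) = s2 at *
  generalize cos (p 2) = k2 at *
  clear * - hc hsc
  grind

lemma gker_coneMap {p : Fin 3 → ℝ} (h0 : p 0 ≠ 0) (h1 : p 1 ∈ Set.Ioo 0 (π / 2)) :
    gker (WithLp.toLp 2 (coneMap p)) = 3 / (4 * π * (|p 0| * cos (p 1))) := by
  have hk : 0 < cos (p 1) := cos_pos_of_mem_Ioo ⟨by linarith [h1.1, pi_pos], h1.2⟩
  have hc : ((√2)⁻¹) ^ 2 = 1 / 2 := by simp
  have hs : (coneMap p 2) ^ 2 - 2 * (coneMap p 0 ^ 2 + coneMap p 1 ^ 2) =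
      (p 0 * cos (p 1)) ^ 2 := by
    have e1 := sin_sq_add_cos_sq (p 1)
    have e2 := sin_sq_add_cos_sq (p 2)
    simp only [coneMap, Matrix.cons_val]
    generalize (√2)⁻¹ = c at *
    generalize sin (p 1) = s1 at *
    generalize cos (p 1) = k1 at *
    generalize sin (p 2) = s2 at *
    generalize cos (p 2) = k2 at *
    clear * - hc e1 e2
    grind
  have hpos : 0 < (p 0 * cos (p 1)) ^ 2 := by positivity
  simp only [gker]
  rw [if_pos (by linarith), hs, sqrt_sq_eq_abs, abs_mul, abs_of_pos hk]

lemma abs_det_mul_gker_coneMap {p : Fin 3 → ℝ} (h0 : p 0 ≠ 0) (h1 : p 1 ∈ Set.Ioo 0 (π / 2)) :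
    |(fderiv ℝ coneMap p).det| * gker (WithLp.toLp 2 (coneMap p)) =
      3 / (8 * π) * (|p 0| * sin (p 1)) := by
  have hk : 0 < cos (p 1) := cos_pos_of_mem_Ioo ⟨by linarith [h1.1, pi_pos], h1.2⟩
  have hs : 0 < sin (p 1) := sin_pos_of_pos_of_lt_pi h1.1 (by linarith [h1.2, pi_pos])
  have ha : 0 < |p 0| := abs_pos.2 h0
  rw [gker_coneMap h0 h1, det_fderiv_coneMap, abs_of_nonneg (by positivity), ← sq_abs (p 0)]
  have := pi_pos
  field_simp
  ring

lemma injOn_coneMap :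
    Set.InjOn coneMap {p | p 0 ≠ 0 ∧ p 1 ∈ Set.Ioo 0 (π / 2) ∧ p 2 ∈ Set.Ioo (-π) π} := by
  rintro p ⟨hp0, hp1, hp2⟩ q ⟨-, hq1, hq2⟩ h
  have e0 : p 0 = q 0 := congrFun h 2
  have e1 := congrFun h 0
  have e2 := congrFun h 1
  simp only [coneMap, Matrix.cons_val, ← e0, mul_assoc] at e1 e2
  have hc : (√2)⁻¹ ≠ 0 := by positivity
  have e1 := mul_left_cancel₀ hp0 (mul_left_cancel₀ hc e1)
  have e2 := mul_left_cancel₀ hp0 (mul_left_cancel₀ hc e2)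
  have hsp : 0 < sin (p 1) := sin_pos_of_pos_of_lt_pi hp1.1 (by linarith [hp1.2, pi_pos])
  have hsq : 0 < sin (q 1) := sin_pos_of_pos_of_lt_pi hq1.1 (by linarith [hq1.2, pi_pos])
  have hs : sin (p 1) = sin (q 1) := by
    rw [← sq_eq_sq₀ hsp.le hsq.le]
    linear_combination (sin (p 1) * cos (p 2) + sin (q 1) * cos (q 2)) * e1 +
      (sin (p 1) * sin (p 2) + sin (q 1) * sin (q 2)) * e2 -
      sin (p 1) ^ 2 * sin_sq_add_cos_sq (p 2) + sin (q 1) ^ 2 * sin_sq_add_cos_sq (q 2)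
  have e3 : p 1 = q 1 := injOn_sin ⟨by linarith [hp1.1, pi_pos], hp1.2.le⟩
    ⟨by linarith [hq1.1, pi_pos], hq1.2.le⟩ hs
  rw [← hs] at e1 e2
  have e1 := mul_left_cancel₀ hsp.ne' e1
  have e2 := mul_left_cancel₀ hsp.ne' e2
  have e4 : p 2 = q 2 := by
    rw [← Complex.arg_cos_add_sin_mul_I ⟨hp2.1, hp2.2.le⟩,
      ← Complex.arg_cos_add_sin_mul_I ⟨hq2.1, hq2.2.le⟩, ← Complex.ofReal_cos,
      ← Complex.ofReal_sin, ← Complex.ofReal_cos, ← Complex.ofReal_sin, e1, e2]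
  ext i
  fin_cases i <;> assumption

lemma exists_coneMap_eq {y : Fin 3 → ℝ} (hy : 2 * (y 0 ^ 2 + y 1 ^ 2) < y 2 ^ 2) (hy1 : y 1 ≠ 0) :
    ∃ α ∈ Set.Ioo 0 (π / 2), ∃ θ ∈ Set.Ioo (-π) π, coneMap ![y 2, α, θ] = y := by
  have ht : y 2 ≠ 0 := by
    intro h
    rw [h] at hy
    nlinarith [sq_nonneg (y 0), sq_nonneg (y 1)]
  set z : ℂ := ⟨y 0 / y 2, y 1 / y 2⟩ with hz
  have him : z.im ≠ 0 := div_ne_zero hy1 ht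
  have hz0 : 0 < ‖z‖ := norm_pos_iff.2 fun h => him (by simp [h])
  have hsq : (√2 * ‖z‖) ^ 2 < 1 := by
    rw [mul_pow, Complex.sq_norm, Complex.normSq_apply, sq_sqrt (by norm_num)]
    have : 0 < y 2 ^ 2 := by positivity
    simp only [hz]
    calc _ = 2 * (y 0 ^ 2 + y 1 ^ 2) / y 2 ^ 2 := by field_simp
      _ < 1 := (div_lt_one this).2 hy
  have hlt : √2 * ‖z‖ < 1 := by
    exact (le_abs_self _).trans_lt ((sq_lt_one_iff_abs_lt_one _).1 hsq)
  have hpos : 0 < √2 * ‖z‖ := by positivity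
  refine ⟨arcsin (√2 * ‖z‖), ⟨arcsin_pos.2 hpos, arcsin_lt_pi_div_two.2 hlt⟩, z.arg,
    ⟨Complex.neg_pi_lt_arg z, lt_of_le_of_ne (Complex.arg_le_pi z) fun h =>
      him (Complex.arg_eq_pi_iff.1 h).2⟩, ?_⟩
  have hsin : sin (arcsin (√2 * ‖z‖)) = √2 * ‖z‖ := sin_arcsin (by linarith) hlt.le
  have hre := Complex.norm_mul_cos_arg z
  have hims := Complex.norm_mul_sin_arg z
  have hzre : z.re = y 0 / y 2 := rfl
  have hzim : z.im = y 1 / y 2 := rfl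
  have hc : (√2)⁻¹ * √2 = 1 := inv_mul_cancel₀ (by positivity)
  ext i
  fin_cases i
  · simp only [coneMap, hsin, Matrix.cons_val, Fin.zero_eta]
    calc _ = ((√2)⁻¹ * √2) * y 2 * (‖z‖ * cos z.arg) := by ring
      _ = y 0 := by rw [hc, hre, hzre]; field_simp
  · simp only [coneMap, hsin, Matrix.cons_val, Fin.mk_one]
    calc _ = ((√2)⁻¹ * √2) * y 2 * (‖z‖ * sin z.arg) := by ring
      _ = y 1 := by rw [hc, hims, hzim]; field_simp
  · simp [coneMap]

/-- The open box `a < t < b`, `0 < α < π / 2`, `-π < θ < π` in cone coordinates. -/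
def coneBox (a b : ℝ) : Set (Fin 3 → ℝ) :=
  Set.univ.pi fun i => Set.Ioo (![a, 0, -π] i) (![b, π / 2, π] i)

lemma mem_coneBox {a b : ℝ} {p : Fin 3 → ℝ} :
    p ∈ coneBox a b ↔
      p 0 ∈ Set.Ioo a b ∧ p 1 ∈ Set.Ioo 0 (π / 2) ∧ p 2 ∈ Set.Ioo (-π) π := by
  simp [coneBox, Fin.forall_fin_succ]

lemma measurableSet_coneBox (a b : ℝ) : MeasurableSet (coneBox a b) :=
  MeasurableSet.univ_pi fun _ => measurableSet_Ioo

lemma coneBox_ae_eq_Icc (a b : ℝ) :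
    coneBox a b =ᵐ[volume] Set.Icc ![a, 0, -π] ![b, π / 2, π] :=
  Measure.univ_pi_Ioo_ae_eq_Icc

lemma integrableOn_and_integral_coneBox {φ : E3 → ℝ} (hφ : ContDiff ℝ (⊤ : ℕ∞) φ) {a b σ : ℝ}
    (hσ : ∀ t ∈ Set.Ioo a b, t ≠ 0 ∧ |t| = σ * t) :
    IntegrableOn (fun p => |(fderiv ℝ coneMap p).det| •
        (gker (WithLp.toLp 2 (coneMap p)) * Pop φ (WithLp.toLp 2 (coneMap p)))) (coneBox a b) ∧
      ∫ p in coneBox a b, |(fderiv ℝ coneMap p).det| •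
        (gker (WithLp.toLp 2 (coneMap p)) * Pop φ (WithLp.toLp 2 (coneMap p))) =
      σ / (4 * π) * ∫ p in Set.Icc ![a, 0, -π] ![b, π / 2, π],
        3 / 2 * (p 0 * sin (p 1)) * Pop φ (WithLp.toLp 2 (coneMap p)) := by
  have heq : Set.EqOn (fun p => |(fderiv ℝ coneMap p).det| •
      (gker (WithLp.toLp 2 (coneMap p)) * Pop φ (WithLp.toLp 2 (coneMap p))))
      (fun p => σ / (4 * π) *
        (3 / 2 * (p 0 * sin (p 1)) * Pop φ (WithLp.toLp 2 (coneMap p)))) (coneBox a b) := by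
    intro p hp
    obtain ⟨h0, h1, -⟩ := mem_coneBox.1 hp
    simp only [smul_eq_mul, ← mul_assoc]
    rw [abs_det_mul_gker_coneMap (hσ _ h0).1 h1, (hσ _ h0).2]
    ring
  constructor
  · rw [integrableOn_congr_fun heq (measurableSet_coneBox a b),
      integrableOn_congr_set_ae (coneBox_ae_eq_Icc a b)]
    exact (integrableOn_divergence_waveField hφ _ _).const_mul _
  · rw [setIntegral_congr_fun (measurableSet_coneBox a b) heq,
      setIntegral_congr_set (coneBox_ae_eq_Icc a b), integral_const_mul]

end ChangeOfVariables

/-- `g` is a fundamental solution of `P(∂)`: for every smooth compactly supported `φ`,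
`∫ g · P(∂)φ = φ(0)`. -/
theorem stmt9 (φ : E3 → ℝ) (hφ : ContDiff ℝ (⊤ : ℕ∞) φ) (hsupp : HasCompactSupport φ) :
    ∫ x : E3, gker x * Pop φ x = φ 0 := by
  obtain ⟨R, hR, hRs⟩ : ∃ R : ℝ, 0 ≤ R ∧ ∀ x ∈ tsupport φ, |x 2| < R := by
    obtain ⟨r, hr0, hr⟩ := hsupp.isCompact.isBounded.exists_pos_norm_lt
    exact ⟨r, hr0.le, fun x hx => (PiLp.norm_apply_le x 2).trans_lt (hr x hx)⟩
  set S := coneBox (-R) 0 ∪ coneBox 0 R with hS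
  have hSm : MeasurableSet S := (measurableSet_coneBox _ _).union (measurableSet_coneBox _ _)
  have hSsub : S ⊆ {p | p 0 ≠ 0 ∧ p 1 ∈ Set.Ioo 0 (Real.pi / 2) ∧
      p 2 ∈ Set.Ioo (-Real.pi) Real.pi} := by
    rintro p (hp | hp) <;> obtain ⟨h0, h1, h2⟩ := mem_coneBox.1 hp
    · exact ⟨h0.2.ne, h1, h2⟩
    · exact ⟨h0.1.ne', h1, h2⟩
  have hdisj : Disjoint (coneBox (-R) 0) (coneBox 0 R) :=
    Set.disjoint_left.2 fun p hp hq =>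
      lt_asymm (mem_coneBox.1 hp).1.2 (mem_coneBox.1 hq).1.1
  have hneg := integrableOn_and_integral_coneBox hφ (a := -R) (b := 0) (σ := -1)
    fun t ht => ⟨ht.2.ne, by rw [abs_of_neg ht.2]; ring⟩
  have hpos := integrableOn_and_integral_coneBox hφ (a := 0) (b := R) (σ := 1)
    fun t ht => ⟨ht.1.ne', by rw [abs_of_pos ht.1]; ring⟩
  have hzero : ∀ᵐ y : Fin 3 → ℝ, y ∉ coneMap '' S →
      gker (WithLp.toLp 2 y) * Pop φ (WithLp.toLp 2 y) = 0 := by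
    have hnull : ∀ᵐ y : Fin 3 → ℝ, y 1 ≠ 0 :=
      compl_mem_ae_iff.2 (Measure.pi_hyperplane (fun _ : Fin 3 => volume) 1 0)
    filter_upwards [hnull] with y hy1 hyS
    by_contra hne
    obtain ⟨hg, hP⟩ := mul_ne_zero_iff.1 hne
    have hcone : 2 * (y 0 ^ 2 + y 1 ^ 2) < y 2 ^ 2 := by
      by_contra h
      exact hg (if_neg h)
    have hy2 : |y 2| < R := by
      by_contra h
      exact hP (Pop_eq_zero_of_notMem_tsupport fun hx => h (hRs _ hx))
    obtain ⟨α, hα, θ, hθ, hy⟩ := exists_coneMap_eq hcone hy1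
    refine hyS ⟨_, ?_, hy⟩
    have ht : y 2 ≠ 0 := by
      intro h
      rw [h] at hcone
      nlinarith [sq_nonneg (y 0), sq_nonneg (y 1)]
    rcases lt_or_gt_of_ne ht with h | h
    · exact Or.inl (mem_coneBox.2 ⟨⟨(abs_lt.1 hy2).1, h⟩, hα, hθ⟩)
    · exact Or.inr (mem_coneBox.2 ⟨⟨h, (abs_lt.1 hy2).2⟩, hα, hθ⟩)
  rw [← (PiLp.volume_preserving_toLp (Fin 3)).integral_comp
      (MeasurableEquiv.toLp 2 (Fin 3 → ℝ)).measurableEmbedding,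
    ← setIntegral_eq_integral_of_ae_compl_eq_zero hzero,
    integral_image_eq_integral_abs_det_fderiv_smul volume hSm
      (fun p _ => (contDiff_coneMap.differentiable (by simp) p).hasFDerivAt.hasFDerivWithinAt)
      (injOn_coneMap.mono hSsub) fun y => gker (WithLp.toLp 2 y) * Pop φ (WithLp.toLp 2 y),
    setIntegral_union hdisj (measurableSet_coneBox _ _) hneg.1 hpos.1, hneg.2, hpos.2,
    integral_sin_mul_Pop_neg hφ hR hRs, integral_sin_mul_Pop_pos hφ hR hRs]
  have := Real.pi_pos
  field_simp
  ring
end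

section
/- The inverse problem of QSM is ill-posed on L²: for the Fourier multiplier operator M on L²(ℝ³, ℂ) with symbol D(ξ) = 1/3 − ξ₃²/|ξ|², there is no constant C > 0 such that ‖χ‖_{L²} ≤ C‖Mχ‖_{L²} for all χ ∈ L²(ℝ³, ℂ); equivalently, for every C > 0 there exists χ ∈ L²(ℝ³, ℂ) with ‖χ‖_{L²} > C‖Mχ‖_{L²}. -/
open MeasureTheory

/-- The space `L²(ℝ³, ℂ)`. -/
abbrev L2C : Type := Lp ℂ 2 (volume : Measure E3)

/-- The QSM Fourier multiplier `D(ξ) = 1/3 - ξ₃²/|ξ|²`. -/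
noncomputable def Dqsm (ξ : E3) : ℝ := 1 / 3 - (ξ 2) ^ 2 / ‖ξ‖ ^ 2

/-- The QSM multiplier is small on a ball around the point `(1, 1, 1)` of its zero cone. -/
theorem exists_ball_abs_Dqsm_le {ε : ℝ} (hε : 0 < ε) :
    ∃ p : E3, ∃ δ > 0, ∀ ξ ∈ Metric.ball p δ, |Dqsm ξ| ≤ ε := by
  let p : E3 := !₂[1, 1, 1]
  have hp : ‖p‖ ^ 2 = 3 := by
    rw [EuclideanSpace.norm_sq_eq]
    simp [p, Fin.sum_univ_three]
    norm_num
  have hDp : Dqsm p = 0 := by simp [Dqsm, hp, p]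
  have hcont : ContinuousAt Dqsm p := by
    have h0 : ‖p‖ ^ 2 ≠ 0 := by rw [hp]; norm_num
    unfold Dqsm
    fun_prop (disch := exact h0)
  obtain ⟨δ, hδ, h⟩ := Metric.continuousAt_iff.mp hcont ε hε
  refine ⟨p, δ, hδ, fun ξ hξ => ?_⟩
  simpa [hDp] using (h hξ).le

/-- For every `ε > 0`, some nonzero `f ∈ L²` is supported where the QSM multiplier is at most `ε`. -/
theorem exists_L2C_Dqsm_mul_le {ε : ℝ} (hε : 0 < ε) :
    ∃ f : L2C, 0 < ‖f‖ ∧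
      ∀ᵐ ξ ∂(volume : Measure E3), ‖(Dqsm ξ : ℂ) * (f : E3 → ℂ) ξ‖ ≤ ε * ‖(f : E3 → ℂ) ξ‖ := by
  obtain ⟨p, δ, hδ, hD⟩ := exists_ball_abs_Dqsm_le hε
  have hfin : volume (Metric.ball p δ) ≠ ⊤ := measure_ball_lt_top.ne
  have hpos : 0 < volume.real (Metric.ball p δ) :=
    ENNReal.toReal_pos (Metric.measure_ball_pos volume p hδ).ne' hfin
  refine ⟨indicatorConstLp 2 measurableSet_ball hfin 1, ?_, ?_⟩
  · rw [norm_indicatorConstLp (by norm_num) (by norm_num)]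
    simpa using Real.rpow_pos_of_pos hpos _
  · filter_upwards [indicatorConstLp_coeFn (p := 2) (hs := measurableSet_ball) (hμs := hfin)
      (c := (1 : ℂ))] with ξ hξ
    rw [hξ]
    by_cases h : ξ ∈ Metric.ball p δ
    · rw [norm_mul, Complex.norm_real, Real.norm_eq_abs]
      exact mul_le_mul_of_nonneg_right (hD ξ h) (norm_nonneg _)
    · simp [Set.indicator_of_notMem h]

/-- The inverse problem of QSM is ill-posed on `L²`: for the Fourier multiplier
operator `M` with symbol `D` (with respect to any unitary Fourier–Plancherel
transform `𝔉` on `L²(ℝ³, ℂ)`), there is no constant `C > 0` with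
`‖χ‖ ≤ C‖Mχ‖` for all `χ`; equivalently, for every `C > 0` there is `χ` with
`‖χ‖ > C‖Mχ‖`. -/
theorem stmt14 (𝔉 : L2C ≃ₗᵢ[ℂ] L2C) (M : L2C →ₗ[ℂ] L2C)
    (hM : ∀ χ : L2C, (𝔉 (M χ) : E3 → ℂ) =ᵐ[(volume : Measure E3)]
      fun ξ => (Dqsm ξ : ℂ) * (𝔉 χ : E3 → ℂ) ξ) :
    (¬∃ C : ℝ, 0 < C ∧ ∀ χ : L2C, ‖χ‖ ≤ C * ‖M χ‖) ∧
      ∀ C : ℝ, 0 < C → ∃ χ : L2C, C * ‖M χ‖ < ‖χ‖ := by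
  have key : ∀ C : ℝ, 0 < C → ∃ χ : L2C, C * ‖M χ‖ < ‖χ‖ := by
    intro C hC
    obtain ⟨f, hf, hle⟩ := exists_L2C_Dqsm_mul_le (ε := 1 / (2 * C)) (by positivity)
    refine ⟨𝔉.symm f, ?_⟩
    have hM' := hM (𝔉.symm f)
    rw [𝔉.apply_symm_apply] at hM'
    have hbound : ‖𝔉 (M (𝔉.symm f))‖ ≤ 1 / (2 * C) * ‖f‖ := by
      refine Lp.norm_le_mul_norm_of_ae_le_mul ?_
      filter_upwards [hM', hle] with ξ h₁ h₂
      rwa [h₁]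
    rw [𝔉.norm_map] at hbound
    rw [𝔉.symm.norm_map]
    calc C * ‖M (𝔉.symm f)‖ ≤ C * (1 / (2 * C) * ‖f‖) := by gcongr
      _ = ‖f‖ / 2 := by field_simp
      _ < ‖f‖ := half_lt_self hf
  refine ⟨?_, key⟩
  rintro ⟨C, hC, h⟩
  obtain ⟨χ, hχ⟩ := key C hC
  exact (h χ).not_gt hχ
end

section
/- Let δ > 0 and let ψ ∈ L²(ℝ³, ℂ) be such that 𝔉ψ(ξ) = 0 for almost every ξ with |D(ξ)| < δ, where D(ξ) = 1/3 − ξ₃²/|ξ|². Then there exists a unique χ ∈ L²(ℝ³, ℂ) with Mχ = ψ, namely χ = 𝔉⁻¹(𝔉ψ/D) (with the quotient set to 0 where 𝔉ψ vanishes), and it satisfies ‖χ‖_{L²} ≤ δ⁻¹‖ψ‖_{L²}. -/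
open MeasureTheory

lemma measurable_Dqsm : Measurable Dqsm := by
  unfold Dqsm
  fun_prop

lemma sq_coord_zero_of_Dqsm_eq_zero {ξ : E3} (h : Dqsm ξ = 0) :
    ξ 0 ^ 2 = 2 * ξ 2 ^ 2 - ξ 1 ^ 2 := by
  have hn : ‖ξ‖ ^ 2 ≠ 0 := by
    intro h0
    simp [Dqsm, h0] at h
  have hs := EuclideanSpace.real_norm_sq_eq ξ
  rw [Fin.sum_univ_three] at hs
  have h' : ξ 2 ^ 2 / ‖ξ‖ ^ 2 = 1 / 3 := (sub_eq_zero.mp h).symm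
  rw [div_eq_iff hn] at h'
  linarith

/-- Every line parallel to the first axis meets the zero cone of `Dqsm` in at most two points,
so the cone is Lebesgue-null. -/
lemma ae_Dqsm_ne_zero : ∀ᵐ ξ : E3, Dqsm ξ ≠ 0 := by
  refine ae_mem_of_ae_add_linearMap_mem
    (LinearMap.toSpanSingleton ℝ E3 (EuclideanSpace.single 0 1)) (volume : Measure ℝ) volume
    (s := {ξ | Dqsm ξ ≠ 0}) (measurable_Dqsm (measurableSet_singleton 0).compl) fun y => ?_
  set r := √(2 * y 2 ^ 2 - y 1 ^ 2)
  refine measure_mono_null (t := {r - y 0, -r - y 0}) (fun t ht => ?_)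
    ((Set.toFinite _).measure_zero _)
  have h := sq_coord_zero_of_Dqsm_eq_zero (not_not.mp ht)
  simp only [LinearMap.toSpanSingleton_apply, PiLp.add_apply, PiLp.smul_apply,
    PiLp.single_apply, smul_eq_mul] at h
  simp only [if_pos, if_neg (by decide : ¬(1 : Fin 3) = 0), if_neg (by decide : ¬(2 : Fin 3) = 0),
    mul_one, mul_zero, add_zero] at h
  have hr : (y 0 + t) ^ 2 = r ^ 2 := by
    rw [Real.sq_sqrt (h ▸ sq_nonneg _), h]
  rcases sq_eq_sq_iff_eq_or_eq_neg.mp hr with h' | h'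
  · left; linarith
  · right; simp only [Set.mem_singleton_iff]; linarith

/-- If the data `ψ ∈ L²` has no frequency content where `|D| < δ`, then the QSM
equation `Mχ = ψ` has a unique solution `χ ∈ L²`, namely `χ = 𝔉⁻¹(𝔉ψ/D)` (with the
quotient set to `0` where `𝔉ψ` vanishes), and it satisfies `‖χ‖ ≤ δ⁻¹‖ψ‖`. Here `𝔉`
is any unitary Fourier–Plancherel transform on `L²(ℝ³, ℂ)` and `M` is the Fourier
multiplier operator with symbol `D` with respect to `𝔉`. -/
theorem stmt15 (𝔉 : L2C ≃ₗᵢ[ℂ] L2C) (M : L2C →ₗ[ℂ] L2C)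
    (hM : ∀ χ : L2C, (𝔉 (M χ) : E3 → ℂ) =ᵐ[(volume : Measure E3)]
      fun ξ => (Dqsm ξ : ℂ) * (𝔉 χ : E3 → ℂ) ξ)
    (δ : ℝ) (hδ : 0 < δ) (ψ : L2C)
    (hψ : ∀ᵐ ξ : E3 ∂(volume : Measure E3), |Dqsm ξ| < δ → (𝔉 ψ : E3 → ℂ) ξ = 0) :
    ∃ χ : L2C, M χ = ψ ∧
      ((𝔉 χ : E3 → ℂ) =ᵐ[(volume : Measure E3)]
        fun ξ => if (𝔉 ψ : E3 → ℂ) ξ = 0 then 0 else (𝔉 ψ : E3 → ℂ) ξ / (Dqsm ξ : ℂ)) ∧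
      ‖χ‖ ≤ δ⁻¹ * ‖ψ‖ ∧
      ∀ χ' : L2C, M χ' = ψ → χ' = χ := by
  have hbound : ∀ᵐ ξ : E3, ‖if (𝔉 ψ : E3 → ℂ) ξ = 0 then 0
      else (𝔉 ψ : E3 → ℂ) ξ / (Dqsm ξ : ℂ)‖ ≤ δ⁻¹ * ‖(𝔉 ψ : E3 → ℂ) ξ‖ := by
    filter_upwards [hψ] with ξ hξ
    split_ifs with h0
    · simp [h0]
    · have hD : δ ≤ |Dqsm ξ| := not_lt.mp fun h => h0 (hξ h)
      rw [norm_div, Complex.norm_real, Real.norm_eq_abs, div_eq_inv_mul]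
      gcongr
  have hF : Measurable (𝔉 ψ : E3 → ℂ) := (Lp.stronglyMeasurable _).measurable
  have hmeas : Measurable fun ξ : E3 => if (𝔉 ψ : E3 → ℂ) ξ = 0 then 0
      else (𝔉 ψ : E3 → ℂ) ξ / (Dqsm ξ : ℂ) :=
    Measurable.ite (hF (measurableSet_singleton 0)) measurable_const
      (hF.div (Complex.measurable_ofReal.comp measurable_Dqsm))
  have hLp := (Lp.memLp (𝔉 ψ)).of_le_mul hmeas.aestronglyMeasurable hbound
  have hχ : (𝔉 (𝔉.symm hLp.toLp) : E3 → ℂ) =ᵐ[volume] fun ξ =>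
      if (𝔉 ψ : E3 → ℂ) ξ = 0 then 0 else (𝔉 ψ : E3 → ℂ) ξ / (Dqsm ξ : ℂ) := by
    rw [𝔉.apply_symm_apply]
    exact hLp.coeFn_toLp
  have hsol : M (𝔉.symm hLp.toLp) = ψ := by
    refine 𝔉.injective (Lp.ext ?_)
    filter_upwards [hM (𝔉.symm hLp.toLp), hχ, ae_Dqsm_ne_zero] with ξ h1 h2 hD
    rw [h1, h2]
    split_ifs with h0
    · rw [h0, mul_zero]
    · exact mul_div_cancel₀ _ (Complex.ofReal_ne_zero.mpr hD)
  refine ⟨𝔉.symm hLp.toLp, hsol, hχ, ?_, fun χ' hχ' => ?_⟩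
  · rw [𝔉.symm.norm_map, ← 𝔉.norm_map ψ]
    refine Lp.norm_le_mul_norm_of_ae_le_mul ?_
    filter_upwards [hLp.coeFn_toLp, hbound] with ξ h1 h2
    rwa [h1]
  · refine 𝔉.injective (Lp.ext ?_)
    have h' := hM χ'
    rw [hχ', ← hsol] at h'
    filter_upwards [h', hM (𝔉.symm hLp.toLp), ae_Dqsm_ne_zero] with ξ h1 h2 hD
    exact mul_left_cancel₀ (Complex.ofReal_ne_zero.mpr hD) (h1.symm.trans h2)
end
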